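/- The 6×6 nonnegative real matrix S_6 with entries S_6(i,j) = (i−j−1)(i−j−2)/2 (explicitly, S_6 has rows [1,3,6,10,15,21], [0,1,3,6,10,15], [0,0,1,3,6,10], [1,0,0,1,3,6], [3,1,0,0,1,3], [6,3,1,0,0,1]) satisfies psdrk(S_6) ≥ 4. -/

import Mathlib

open Matrix

/-- The positive semidefinite rank of a real `m × n` matrix `S`. -/
noncomputable def psdRank {m n : ℕ} (S : Matrix (Fin m) (Fin n) ℝ) : ℕ :=
  sInf {q : ℕ | ∃ (A : Fin m → Matrix (Fin q) (Fin q) ℝ)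
      (B : Fin n → Matrix (Fin q) (Fin q) ℝ),
    (∀ k, (A k).PosSemidef) ∧ (∀ ℓ, (B ℓ).PosSemidef) ∧
    ∀ k ℓ, S k ℓ = ((A k)ᵀ * B ℓ).trace}

/-- The `n × n` matrix with entries `S_n(i,j) = (i-j-1)(i-j-2)/2` for
`1 ≤ i, j ≤ n` (here row `i` corresponds to `Fin n` element `i - 1`). -/
noncomputable def Smat (n : ℕ) : Matrix (Fin n) (Fin n) ℝ := fun i j =>
  (((i : ℕ) : ℝ) - ((j : ℕ) : ℝ) - 1) * (((i : ℕ) : ℝ) - ((j : ℕ) : ℝ) - 2) / 2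

open scoped MatrixOrder Matrix.Norms.L2Operator in
/-- A real positive semidefinite matrix has the form `Cᵀ * C`. -/
theorem Matrix.PosSemidef.exists_eq_transpose_mul_self {n : Type*} [Fintype n]
    {A : Matrix n n ℝ} (hA : A.PosSemidef) : ∃ C : Matrix n n ℝ, A = Cᵀ * C := by
  classical
  exact CStarAlgebra.nonneg_iff_eq_star_mul_self.mp hA.nonneg

/-- Two real positive semidefinite matrices are trace-orthogonal only if their product is zero. -/
theorem Matrix.PosSemidef.mul_eq_zero_of_trace_mul_eq_zero {n : Type*} [Fintype n]
    {A B : Matrix n n ℝ} (hA : A.PosSemidef) (hB : B.PosSemidef) (h : (A * B).trace = 0) :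
    A * B = 0 := by
  obtain ⟨C, rfl⟩ := hA.exists_eq_transpose_mul_self
  obtain ⟨D, rfl⟩ := hB.exists_eq_transpose_mul_self
  have hCD : C * Dᵀ = 0 := by
    rw [← trace_conjTranspose_mul_self_eq_zero_iff, conjTranspose_eq_transpose_of_trivial,
      transpose_mul, transpose_transpose, Matrix.mul_assoc, trace_mul_comm, ← h]
    simp only [Matrix.mul_assoc]
  rw [Matrix.mul_assoc, ← Matrix.mul_assoc C, hCD, Matrix.zero_mul, Matrix.mul_zero]

/-- A matrix of rank at most one over a field is an outer product. -/
theorem Matrix.exists_eq_vecMulVec_of_rank_le_one {m n K : Type*} [Fintype m] [Fintype n]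
    [Field K] {A : Matrix m n K} (hA : A.rank ≤ 1) : ∃ w v, A = vecMulVec w v := by
  classical
  obtain ⟨w, hw⟩ := finrank_le_one_iff.mp hA
  choose c hc using fun j => hw ⟨A *ᵥ Pi.single j 1, Pi.single j 1, rfl⟩
  refine ⟨w, c, ?_⟩
  ext i j
  have := congrFun (congrArg Subtype.val (hc j)) i
  simp at this
  simp [vecMulVec_apply, ← this, mul_comm]

/-- A real positive semidefinite matrix of rank at most one is of the form `u uᵀ`. -/
theorem Matrix.PosSemidef.exists_eq_vecMulVec_self {n : Type*} [Fintype n]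
    {A : Matrix n n ℝ} (hA : A.PosSemidef) (hr : A.rank ≤ 1) : ∃ u, A = vecMulVec u u := by
  obtain ⟨C, rfl⟩ := hA.exists_eq_transpose_mul_self
  rw [rank_transpose_mul_self] at hr
  obtain ⟨w, v, rfl⟩ := exists_eq_vecMulVec_of_rank_le_one hr
  have hw : 0 ≤ w ⬝ᵥ w := by simpa using dotProduct_star_self_nonneg w
  refine ⟨√(w ⬝ᵥ w) • v, ?_⟩
  rw [transpose_vecMulVec, vecMulVec_mul_vecMulVec, smul_vecMulVec, vecMulVec_smul, vecMulVec_smul,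
    smul_smul, Real.mul_self_sqrt hw]

theorem Matrix.mulVecLin_eq_zero_iff {m n K : Type*} [Fintype n] [CommRing K] {A : Matrix m n K} :
    A.mulVecLin = 0 ↔ A = 0 := by
  classical
  rw [← toLin'_apply', LinearEquiv.map_eq_zero_iff]

theorem Matrix.range_mulVecLin_le_ker_iff {l m n K : Type*} [Fintype m] [Fintype n] [CommRing K]
    {A : Matrix l m K} {B : Matrix m n K} :
    LinearMap.range B.mulVecLin ≤ LinearMap.ker A.mulVecLin ↔ A * B = 0 := by
  rw [LinearMap.range_le_ker_iff, ← mulVecLin_mul, mulVecLin_eq_zero_iff]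

/-- If `A ≠ 0` and `D` both annihilate `B`, in size at most three, and `A` annihilates some `C`
that `D` does not, then `B` has rank at most one. -/
theorem Matrix.rank_le_one_of_mul_eq_zero {n K : Type*} [Fintype n] [Field K]
    (hn : Fintype.card n ≤ 3) {A D B C : Matrix n n K} (hA : A ≠ 0) (hAB : A * B = 0)
    (hDB : D * B = 0) (hAC : A * C = 0) (hDC : D * C ≠ 0) : B.rank ≤ 1 := by
  by_contra! hB
  have hrA : 0 < A.rank := by
    refine Nat.pos_of_ne_zero fun h => hA ?_
    rwa [Matrix.rank, Submodule.finrank_eq_zero, LinearMap.range_eq_bot,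
      mulVecLin_eq_zero_iff] at h
  have hker := A.mulVecLin.finrank_range_add_finrank_ker
  rw [Module.finrank_fintype_fun_eq_card] at hker
  have heq : LinearMap.range B.mulVecLin = LinearMap.ker A.mulVecLin := by
    refine Submodule.eq_of_le_of_finrank_le (range_mulVecLin_le_ker_iff.mpr hAB) ?_
    unfold Matrix.rank at hrA hB
    omega
  rw [← range_mulVecLin_le_ker_iff] at hDB hAC
  rw [ne_eq, ← range_mulVecLin_le_ker_iff] at hDC
  exact hDC ((hAC.trans heq.ge).trans hDB)

/-- Every entrywise nonnegative square matrix has a positive semidefinite factorization, by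
diagonal matrices. -/
theorem exists_psd_factorization_of_nonneg {n : ℕ} {S : Matrix (Fin n) (Fin n) ℝ}
    (hS : ∀ i j, 0 ≤ S i j) :
    ∃ (A B : Fin n → Matrix (Fin n) (Fin n) ℝ),
      (∀ k, (A k).PosSemidef) ∧ (∀ l, (B l).PosSemidef) ∧
      ∀ k l, S k l = ((A k)ᵀ * B l).trace := by
  refine ⟨fun k => diagonal (S k), fun l => diagonal (Pi.single l 1),
    fun k => .diagonal (hS k), fun l => .diagonal ?_, fun k l => ?_⟩
  · exact Pi.single_nonneg.mpr zero_le_one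
  · simp [trace_diagonal, Pi.single_apply]

/-- A square matrix that factors through a smaller dimension is singular. -/
theorem Matrix.det_mul_eq_zero_of_card_lt {m n K : Type*} [Fintype m] [Fintype n] [DecidableEq m]
    [Field K] (h : Fintype.card n < Fintype.card m) (U : Matrix m n K) (V : Matrix n m K) :
    (U * V).det = 0 := by
  by_contra hdet
  have hr := rank_of_isUnit (U * V) ((isUnit_iff_isUnit_det _).mpr (Ne.isUnit hdet))
  have := (rank_mul_le_left U V).trans U.rank_le_card_width
  omega

/-- Every Hadamard square root of the bottom left `4 × 4` block of `Smat 6` is nonsingular. -/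
theorem det_ne_zero_of_sq_eq_Smat {N : Matrix (Fin 4) (Fin 4) ℝ}
    (hN : ∀ i j : Fin 4, N i j ^ 2 = Smat 6 (i.natAdd 2) (j.castAdd 2)) : N.det ≠ 0 := by
  intro hdet
  have hzero {i j : Fin 4} (h : Smat 6 (i.natAdd 2) (j.castAdd 2) = 0) : N i j = 0 :=
    pow_eq_zero_iff two_ne_zero |>.mp (by rw [hN, h])
  have h00 : N 0 0 = 0 := hzero (by norm_num [Smat])
  have h01 : N 0 1 = 0 := hzero (by norm_num [Smat])
  have h11 : N 1 1 = 0 := hzero (by norm_num [Smat])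
  have h12 : N 1 2 = 0 := hzero (by norm_num [Smat])
  have h22 : N 2 2 = 0 := hzero (by norm_num [Smat])
  have h23 : N 2 3 = 0 := hzero (by norm_num [Smat])
  have h33 : N 3 3 = 0 := hzero (by norm_num [Smat])
  have hx : (N 0 2 * N 1 3 * N 2 0 * N 3 1) ^ 2 = 9 := by
    simp only [mul_pow, hN]
    norm_num [Smat]
  have hy : (N 0 2 * N 1 3 * N 2 1 * N 3 0) ^ 2 = 6 := by
    simp only [mul_pow, hN]
    norm_num [Smat]
  have hz : (N 0 3 * N 1 0 * N 2 1 * N 3 2) ^ 2 = 3 := by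
    simp only [mul_pow, hN]
    norm_num [Smat]
  have hxyz : N 0 2 * N 1 3 * N 2 0 * N 3 1 =
      N 0 2 * N 1 3 * N 2 1 * N 3 0 + N 0 3 * N 1 0 * N 2 1 * N 3 2 := by
    simp [det_succ_row_zero, Fin.sum_univ_succ, Fin.succAbove, h00, h01, h11, h12, h22, h23,
      h33] at hdet
    linear_combination hdet
  generalize N 0 2 * N 1 3 * N 2 1 * N 3 0 = y at hy hxyz
  generalize N 0 3 * N 1 0 * N 2 1 * N 3 2 = z at hz hxyz
  have hyz : y * z = 0 := by
    rw [hxyz] at hx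
    linear_combination (hx - hy - hz) / 2
  have : (y * z) ^ 2 = 6 * 3 := by rw [mul_pow, hy, hz]
  norm_num [hyz] at this

/-- A positive semidefinite factorization of `Smat 6` has size at least four. -/
theorem four_le_of_psd_factorization {q : ℕ} {A B : Fin 6 → Matrix (Fin q) (Fin q) ℝ}
    (hA : ∀ k, (A k).PosSemidef) (hB : ∀ l, (B l).PosSemidef)
    (hS : ∀ k l, Smat 6 k l = ((A k)ᵀ * B l).trace) : 4 ≤ q := by
  by_contra! hq
  have hcard : Fintype.card (Fin q) ≤ 3 := by rw [Fintype.card_fin]; omega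
  have htrans {M : Matrix (Fin q) (Fin q) ℝ} (hM : M.PosSemidef) : Mᵀ = M := by
    simpa using hM.isHermitian.eq
  have htr k l : Smat 6 k l = (A k * B l).trace := by rw [hS, htrans (hA k)]
  have hzero {k l} (h : Smat 6 k l = 0) : A k * B l = 0 :=
    (hA k).mul_eq_zero_of_trace_mul_eq_zero (hB l) (by rw [← htr, h])
  have hzero' {k l} (h : Smat 6 k l = 0) : B l * A k = 0 := by
    rw [← htrans (hA k), ← htrans (hB l), ← transpose_mul, hzero h, transpose_zero]
  have hne {k l} (h : Smat 6 k l ≠ 0) : A k * B l ≠ 0 := fun h0 => h (by rw [htr, h0, trace_zero])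
  have hne' {k l} (h : Smat 6 k l ≠ 0) : B l * A k ≠ 0 := fun h0 =>
    h (by rw [htr, trace_mul_comm, h0, trace_zero])
  have hrA (i : Fin 4) : (A (i.natAdd 2)).rank ≤ 1 := by
    refine rank_le_one_of_mul_eq_zero hcard (A := B (i.castAdd 2))
      (D := B (i.succ.castAdd 1)) (C := A (i.succ.castAdd 1)) ?_ (hzero' ?_) (hzero' ?_)
      (hzero' ?_) (hne' ?_)
    · refine left_ne_zero_of_mul (hne' (k := 0) (l := i.castAdd 2) ?_)
      fin_cases i <;> norm_num [Smat]
    all_goals fin_cases i <;> norm_num [Smat]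
  have hrB (j : Fin 4) : (B (j.castAdd 2)).rank ≤ 1 := by
    refine rank_le_one_of_mul_eq_zero hcard (A := A (j.natAdd 2))
      (D := A (j.succ.castAdd 1)) (C := B (j.succ.castAdd 1)) ?_ (hzero ?_) (hzero ?_)
      (hzero ?_) (hne ?_)
    · refine left_ne_zero_of_mul (hne (k := j.natAdd 2) (l := 5) ?_)
      fin_cases j <;> norm_num [Smat]
    all_goals fin_cases j <;> norm_num [Smat]
  choose u hu using fun i => (hA _).exists_eq_vecMulVec_self (hrA i)
  choose v hv using fun j => (hB _).exists_eq_vecMulVec_self (hrB j)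
  refine det_ne_zero_of_sq_eq_Smat (N := of u * (of v)ᵀ) (fun i j => ?_)
    (det_mul_eq_zero_of_card_lt (by simpa using hq) _ _)
  rw [htr, hu, hv, vecMulVec_mul_vecMulVec, trace_vecMulVec, dotProduct_smul,
    smul_eq_mul, sq]
  rfl

theorem psdRank_S6_ge_four :
    Smat 6 = !![1, 3, 6, 10, 15, 21;
                0, 1, 3, 6, 10, 15;
                0, 0, 1, 3, 6, 10;
                1, 0, 0, 1, 3, 6;
                3, 1, 0, 0, 1, 3;
                6, 3, 1, 0, 0, 1] ∧
    4 ≤ psdRank (Smat 6) := by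
  have hS : Smat 6 = !![1, 3, 6, 10, 15, 21;
                0, 1, 3, 6, 10, 15;
                0, 0, 1, 3, 6, 10;
                1, 0, 0, 1, 3, 6;
                3, 1, 0, 0, 1, 3;
                6, 3, 1, 0, 0, 1] := by
    ext i j
    fin_cases i <;> fin_cases j <;> norm_num [Smat]
  refine ⟨hS, le_csInf ⟨6, exists_psd_factorization_of_nonneg fun i j => ?_⟩ ?_⟩
  · rw [hS]
    fin_cases i <;> fin_cases j <;> norm_num
  · rintro q ⟨A, B, hA, hB, h⟩
    exact four_le_of_psd_factorization hA hB h
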